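/- Let S = {s_1, …, s_n}, 𝒞 = {C_1, …, C_m}, k a natural number, N > n a real number, and G the associated reduction digraph. If T is a directed subtree of G rooted at r with total edge weight at most kN + n and at least k + n + 1 vertices, then T contains at most k of the set-vertices C_1, …, C_m, and T contains all n element-vertices s_1, …, s_n. -/

import Mathlib

/-- Vertex type of the reduction digraph: `none` is the root `r`,
`some (Sum.inl C)` is the set-vertex for a set `C`, and
`some (Sum.inr s)` is the element-vertex for an element `s`. -/
abbrev RedVertex (α : Type*) := Option (Finset α ⊕ α)

/-- Edge relation of the reduction digraph associated to the family `𝒞`: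
an edge from the root to each set-vertex `C ∈ 𝒞`, and an edge from a
set-vertex `C ∈ 𝒞` to an element-vertex `s` whenever `s ∈ C`. -/
def redEdge {α : Type*} (𝒞 : Finset (Finset α)) : RedVertex α → RedVertex α → Prop
  | none, some (Sum.inl C) => C ∈ 𝒞
  | some (Sum.inl C), some (Sum.inr s) => C ∈ 𝒞 ∧ s ∈ C
  | _, _ => False

/-- Edge weights of the reduction digraph: weight `N` on edges from the root to a
set-vertex, weight `1` on edges from a set-vertex to an element-vertex. -/
def redWeight {α : Type*} (N : ℝ) : RedVertex α → RedVertex α → ℝ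
  | none, some (Sum.inl _) => N
  | some (Sum.inl _), some (Sum.inr _) => 1
  | _, _ => 0

/-- A directed subtree of the digraph with edge relation `E`, rooted at `r`,
with all edges oriented away from `r`: a finite vertex set containing `r`
together with a parent assignment for the non-root vertices, such that every
parent edge is an edge of the digraph and every vertex is connected to the root
(witnessed by a depth function strictly decreasing towards the root). -/
structure DirectedSubtree {V : Type*} (E : V → V → Prop) (r : V) where
  verts : Finset V
  parent : V → V
  depth : V → ℕ
  root_mem : r ∈ verts
  parent_mem : ∀ v ∈ verts, v ≠ r → parent v ∈ verts
  parent_edge : ∀ v ∈ verts, v ≠ r → E (parent v) v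
  depth_lt : ∀ v ∈ verts, v ≠ r → depth (parent v) < depth v

/-- The cost of a rooted subtree: the sum of the weights of its edges,
one edge `(parent v, v)` for every non-root vertex `v`. -/
def treeCost {V : Type*} [DecidableEq V] {E : V → V → Prop} {r : V}
    (c : V → V → ℝ) (T : DirectedSubtree E r) : ℝ :=
  ∑ v ∈ T.verts.erase r, c (T.parent v) v

theorem redEdge_inl {α : Type*} {𝒞 : Finset (Finset α)} {u : RedVertex α} {C : Finset α}
    (h : redEdge 𝒞 u (some (Sum.inl C))) : u = none ∧ C ∈ 𝒞 := by
  rcases u with _ | _ | _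
  · exact ⟨rfl, h⟩
  · exact h.elim
  · exact h.elim

theorem redEdge_inr {α : Type*} {𝒞 : Finset (Finset α)} {u : RedVertex α} {s : α}
    (h : redEdge 𝒞 u (some (Sum.inr s))) :
    ∃ C ∈ 𝒞, u = some (Sum.inl C) ∧ s ∈ C := by
  rcases u with _ | C | _
  · exact h.elim
  · exact ⟨C, h.1, rfl, h.2⟩
  · exact h.elim

theorem DirectedSubtree.verts_eq_insertNone {α : Type*} [DecidableEq α]
    {S : Finset α} {𝒞 : Finset (Finset α)} (hsub : ∀ C ∈ 𝒞, C ⊆ S)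
    (T : DirectedSubtree (redEdge 𝒞) (none : RedVertex α)) :
    T.verts = Finset.insertNone
      ((𝒞.filter fun C => (some (Sum.inl C) : RedVertex α) ∈ T.verts).disjSum
        (S.filter fun s => (some (Sum.inr s) : RedVertex α) ∈ T.verts)) := by
  ext v
  rcases v with _ | C | s
  · simpa using T.root_mem
  · have h (hv : some (Sum.inl C) ∈ T.verts) : C ∈ 𝒞 :=
      (redEdge_inl (T.parent_edge _ hv (by simp))).2
    simpa using h
  · have h (hv : some (Sum.inr s) ∈ T.verts) : s ∈ S := by
      obtain ⟨C, hC, -, hs⟩ := redEdge_inr (T.parent_edge _ hv (by simp))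
      exact hsub C hC hs
    simpa using h

/-- The cost of a subtree is `N` per set-vertex plus `1` per element-vertex. -/
theorem treeCost_redWeight {α : Type*} [DecidableEq α]
    {S : Finset α} {𝒞 : Finset (Finset α)} (hsub : ∀ C ∈ 𝒞, C ⊆ S) (N : ℝ)
    (T : DirectedSubtree (redEdge 𝒞) (none : RedVertex α)) :
    treeCost (redWeight N) T =
      (𝒞.filter fun C => (some (Sum.inl C) : RedVertex α) ∈ T.verts).card * N +
        (S.filter fun s => (some (Sum.inr s) : RedVertex α) ∈ T.verts).card := by
  have herase : T.verts.erase none =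
      ((𝒞.filter fun C => (some (Sum.inl C) : RedVertex α) ∈ T.verts).disjSum
        (S.filter fun s => (some (Sum.inr s) : RedVertex α) ∈ T.verts)).map
          Function.Embedding.some := by
    conv_lhs => rw [T.verts_eq_insertNone hsub]
    ext v
    rcases v with _ | v <;> simp
  rw [treeCost, herase, Finset.sum_map, Finset.sum_disjSum]
  congr 1
  · rw [Finset.sum_congr rfl (g := fun _ => N), Finset.sum_const, nsmul_eq_mul]
    intro C hC
    have h := redEdge_inl (T.parent_edge _ (Finset.mem_filter.mp hC).2 (by simp))
    simp [h.1, redWeight]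
  · rw [Finset.sum_congr rfl (g := fun _ => (1 : ℝ)), Finset.sum_const, nsmul_one]
    intro s hs
    obtain ⟨C, -, h, -⟩ := redEdge_inr (T.parent_edge _ (Finset.mem_filter.mp hs).2 (by simp))
    simp [h, redWeight]

/-- If `T` is a directed subtree of the reduction digraph rooted at `r` of total edge
weight at most `k·N + n` with at least `k + n + 1` vertices (where `n = |S|`), then
`T` contains at most `k` of the set-vertices and all `n` element-vertices. -/
theorem tree_vertex_structure {α : Type*} [DecidableEq α]
    (S : Finset α) (𝒞 : Finset (Finset α)) (hsub : ∀ C ∈ 𝒞, C ⊆ S)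
    (k : ℕ) (N : ℝ) (hN : (S.card : ℝ) < N)
    (T : DirectedSubtree (redEdge 𝒞) (none : RedVertex α))
    (hcost : treeCost (redWeight N) T ≤ k * N + S.card)
    (hsize : k + S.card + 1 ≤ T.verts.card) :
    (𝒞.filter fun C => (some (Sum.inl C) : RedVertex α) ∈ T.verts).card ≤ k ∧
    ∀ s ∈ S, (some (Sum.inr s) : RedVertex α) ∈ T.verts := by
  have hcard := congrArg Finset.card (T.verts_eq_insertNone hsub)
  rw [Finset.card_insertNone, Finset.card_disjSum] at hcard
  rw [treeCost_redWeight hsub] at hcost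
  have hle := Finset.card_filter_le S fun s => (some (Sum.inr s) : RedVertex α) ∈ T.verts
  have hk : (𝒞.filter fun C => (some (Sum.inl C) : RedVertex α) ∈ T.verts).card ≤ k := by
    by_contra! hlt
    have hlt' : (k : ℝ) + 1 ≤
        (𝒞.filter fun C => (some (Sum.inl C) : RedVertex α) ∈ T.verts).card := by
      exact_mod_cast hlt
    have hN0 : 0 ≤ N := (Nat.cast_nonneg _).trans hN.le
    have hmul := mul_le_mul_of_nonneg_right hlt' hN0
    have hnonneg : (0 : ℝ) ≤
        (S.filter fun s => (some (Sum.inr s) : RedVertex α) ∈ T.verts).card := Nat.cast_nonneg _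
    linarith
  exact ⟨hk, Finset.card_filter_eq_iff.mp (by omega)⟩
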